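/- Let E be a finite set and f : 2^E → ℝ≥0 a monotone submodular function with f(∅) = 0. Then: (a) there exists a unique maximal set U ⊆ E with f(U) = 0, i.e., a set U with f(U) = 0 such that every S ⊆ E with f(S) = 0 satisfies S ⊆ U; and (b) every bijection σ : E → {1,…,|E|} minimizing ∑_{i=1}^{|E|} f(E_{i,σ}) satisfies E_{|U|,σ} = U. -/

import Mathlib

/-- The prefix set `E_{i,σ} = {e : σ(e) ≤ i}`, where the bijection `σ : α ≃ Fin m`
is interpreted as a labeling by `{1,…,m}` via `e ↦ (σ e) + 1`. -/
def prefixSet {α : Type*} [Fintype α] [DecidableEq α] {m : ℕ} (σ : α ≃ Fin m) (i : ℕ) :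
    Finset α :=
  Finset.univ.filter fun e => (σ e : ℕ) < i

theorem mem_prefixSet {α : Type*} [Fintype α] [DecidableEq α] {m : ℕ} {σ : α ≃ Fin m} {i : ℕ}
    {e : α} : e ∈ prefixSet σ i ↔ (σ e : ℕ) < i := by
  simp [prefixSet]

theorem card_prefixSet {α : Type*} [Fintype α] [DecidableEq α] {m : ℕ} (σ : α ≃ Fin m) {i : ℕ}
    (hi : i ≤ m) : (prefixSet σ i).card = i := by
  have h : (prefixSet σ i).map σ.toEmbedding = Finset.univ.filter fun k : Fin m => (k : ℕ) < i := by
    ext k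
    simp [prefixSet]
  rw [← Finset.card_map σ.toEmbedding, h, Fin.card_filter_val_lt, min_eq_right hi]

/-- An injective key on a finite type can be replaced by the rank of the key. -/
theorem exists_equiv_fin_lt_iff {α : Type*} [Fintype α] {m : ℕ} (hm : Fintype.card α = m)
    {key : α → ℕ} (hkey : Function.Injective key) :
    ∃ π : α ≃ Fin m, ∀ a b, π a < π b ↔ key a < key b := by
  let _ : LinearOrder α := LinearOrder.lift' key hkey
  let π := (Fintype.orderIsoFinOfCardEq α hm).symm
  exact ⟨π.toEquiv, fun a b => π.lt_iff_lt⟩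

/-- Moving the elements of `U` to the front, without changing the order otherwise. -/
theorem exists_equiv_front {α : Type*} [Fintype α] [DecidableEq α] {m : ℕ} (σ : α ≃ Fin m)
    (U : Finset α) :
    ∃ π : α ≃ Fin m, (∀ i ≤ U.card, prefixSet π i ⊆ U) ∧
      ∀ i ≤ m, prefixSet π i ⊆ prefixSet σ i ∪ U := by
  let key : α → ℕ := fun e => (if e ∈ U then 0 else m) + σ e
  have hkey : Function.Injective key := by
    intro a b hab
    have ha := (σ a).isLt
    have hb := (σ b).isLt
    apply σ.injective
    apply Fin.ext
    simp only [key] at hab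
    split_ifs at hab <;> omega
  have hm : Fintype.card α = m := by simpa using Fintype.card_congr σ
  obtain ⟨π, hπ⟩ := exists_equiv_fin_lt_iff hm hkey
  have hcard : ∀ (e : α) (S : Finset α), (∀ x ∈ S, key x < key e) → S.card ≤ (π e : ℕ) := by
    intro e S hS
    rw [← card_prefixSet π (π e).isLt.le]
    exact Finset.card_le_card fun x hx => mem_prefixSet.2 ((hπ x e).2 (hS x hx))
  refine ⟨π, fun i hi e he => ?_, fun i hi e he => ?_⟩
  · by_contra heU
    have h := hcard e U fun x hx => by
      have := (σ x).isLt
      simp only [key, hx, heU, if_true, if_false]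
      omega
    have := mem_prefixSet.1 he
    omega
  · by_contra hne
    simp only [Finset.mem_union, mem_prefixSet, not_or, not_lt] at hne
    have h := hcard e (prefixSet σ i) fun x hx => by
      have := mem_prefixSet.1 hx
      simp only [key, hne.2, if_false]
      split_ifs <;> omega
    rw [card_prefixSet σ hi] at h
    have := mem_prefixSet.1 he
    omega

theorem stmt_6 {α : Type*} [Fintype α] [DecidableEq α] {m : ℕ}
    (hm : Fintype.card α = m) (f : Finset α → ℝ)
    (hnn : ∀ S : Finset α, 0 ≤ f S)
    (hmono : ∀ S T : Finset α, S ⊆ T → f S ≤ f T)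
    (hsub : ∀ S T : Finset α, f (S ∪ T) + f (S ∩ T) ≤ f S + f T)
    (hzero : f ∅ = 0) :
    ∃ U : Finset α,
      (f U = 0 ∧ ∀ S : Finset α, f S = 0 → S ⊆ U) ∧
      ∀ σ : α ≃ Fin m,
        (∀ π : α ≃ Fin m,
          ∑ i ∈ Finset.range m, f (prefixSet σ (i + 1)) ≤
            ∑ i ∈ Finset.range m, f (prefixSet π (i + 1))) →
        prefixSet σ U.card = U := by
  classical
  obtain ⟨U, hU, hmax⟩ : ∃ U : Finset α, f U = 0 ∧ ∀ S : Finset α, f S = 0 → S ⊆ U := by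
    refine ⟨(Finset.univ.filter fun S => f S = 0).sup id, ?_, fun S hS => ?_⟩
    · refine Finset.sup_induction (p := fun S => f S = 0) hzero (fun S hS T hT => ?_) (by simp)
      have := hsub S T
      have := hnn (S ∩ T)
      have := hnn (S ∪ T)
      change f (S ∪ T) = 0
      linarith
    · exact Finset.le_sup (f := id) (by simpa using hS)
  refine ⟨U, ⟨hU, hmax⟩, fun σ hσ => ?_⟩
  have hUm : U.card ≤ m := hm ▸ U.card_le_univ
  obtain ⟨π, hπU, hπσ⟩ := exists_equiv_front σ U
  have hle : ∀ i ∈ Finset.range m, f (prefixSet π (i + 1)) ≤ f (prefixSet σ (i + 1)) := by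
    intro i hi
    have := hmono _ _ (hπσ (i + 1) (Finset.mem_range.1 hi))
    have := hsub (prefixSet σ (i + 1)) U
    have := hnn (prefixSet σ (i + 1) ∩ U)
    linarith
  have heq := (Finset.sum_eq_sum_iff_of_le hle).1 (le_antisymm (Finset.sum_le_sum hle) (hσ π))
  have hσU : f (prefixSet σ U.card) = 0 := by
    rcases Nat.eq_zero_or_pos U.card with h0 | hpos
    · simpa [h0, prefixSet] using hzero
    · have h := heq (U.card - 1) (Finset.mem_range.2 (by omega))
      rw [Nat.sub_add_cancel hpos] at h
      rw [← h]
      exact le_antisymm (hU ▸ hmono _ _ (hπU _ le_rfl)) (hnn _)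
  exact Finset.eq_of_subset_of_card_le (hmax _ hσU) (card_prefixSet σ hUm).ge
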